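/- Let X ⊂ ℝ^d be a relatively separated set, ν an admissible weight satisfying ν(x) ≥ C₀ (1+|x|)^δ for some δ ∈ (0,1] and C₀ > 0, and α = (α₁,…,α_d) ∈ ℕ₀^d. If a B(H)-valued matrix A = [A_{k,l}]_{k,l∈X} satisfies the anisotropic Schur-type conditions sup_{k∈X} Σ_{l∈X} ∏_{j=1}^d (1+|k_j−l_j|)^{α_j} ‖A_{k,l}‖ ν(k−l) < ∞ and sup_{l∈X} Σ_{k∈X} ∏_{j=1}^d (1+|k_j−l_j|)^{α_j} ‖A_{k,l}‖ ν(k−l) < ∞, and the bounded operator on ℓ²(X;H) defined by A is invertible, then the canonical matrix representation of the inverse operator satisfies the same two anisotropic Schur-type conditions. -/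

import Mathlib

open scoped ENNReal
open Set Filter

noncomputable section

/-- `ℝ^d` with the Euclidean norm. -/
abbrev Euc (d : ℕ) := EuclideanSpace ℝ (Fin d)

/-- A set `X ⊂ ℝ^d` is relatively separated if
`sup_{x ∈ ℝ^d} #(X ∩ (x + [0,1]^d)) < ∞`. -/
def RelSep {d : ℕ} (X : Set (Euc d)) : Prop :=
  ∃ N : ℕ, ∀ x : Euc d,
    (X ∩ {y | ∀ j, x j ≤ y j ∧ y j ≤ x j + 1}).Finite ∧
    (X ∩ {y | ∀ j, x j ≤ y j ∧ y j ≤ x j + 1}).ncard ≤ N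

/-- A function `nrm : ℝ^d → ℝ` is a norm on `ℝ^d`. -/
def IsNormOn {d : ℕ} (nrm : Euc d → ℝ) : Prop :=
  (∀ x, 0 ≤ nrm x) ∧ (∀ x, nrm x = 0 ↔ x = 0) ∧
  (∀ (c : ℝ) (x), nrm (c • x) = |c| * nrm x) ∧
  (∀ x y, nrm (x + y) ≤ nrm x + nrm y)

/-- An admissible weight: `ν(x) = e^{ρ(‖x‖)}` for some continuous concave
`ρ : [0,∞) → [0,∞)` with `ρ(0) = 0` and some norm `‖·‖` on `ℝ^d`, and `ν`
satisfies the GRS-condition. -/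
def Admissible {d : ℕ} (ν : Euc d → ℝ) : Prop :=
  (∃ (ρ : ℝ → ℝ) (nrm : Euc d → ℝ), IsNormOn nrm ∧
      ContinuousOn ρ (Set.Ici 0) ∧ ConcaveOn ℝ (Set.Ici 0) ρ ∧ ρ 0 = 0 ∧
      (∀ t ∈ Set.Ici (0 : ℝ), 0 ≤ ρ t) ∧ (∀ x, ν x = Real.exp (ρ (nrm x)))) ∧
  (∀ z : Euc d, Tendsto (fun n : ℕ => (ν ((n : ℝ) • z)) ^ (1 / (n : ℝ)))
    atTop (nhds 1))

/-- The anisotropic Schur-type conditions with weight `ν` and multi-index `α`. -/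
def MemAnisoSchur {d : ℕ} {X : Set (Euc d)} {H : Type*}
    [NormedAddCommGroup H] [InnerProductSpace ℂ H]
    (ν : Euc d → ℝ) (α : Fin d → ℕ) (A : ↥X → ↥X → (H →L[ℂ] H)) : Prop :=
  (∀ k : ↥X, Summable fun l : ↥X =>
    (∏ j : Fin d, (1 + |(k : Euc d) j - (l : Euc d) j|) ^ (α j)) *
      ‖A k l‖ * ν ((k : Euc d) - (l : Euc d))) ∧
  BddAbove (Set.range fun k : ↥X => ∑' l : ↥X,
    (∏ j : Fin d, (1 + |(k : Euc d) j - (l : Euc d) j|) ^ (α j)) *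
      ‖A k l‖ * ν ((k : Euc d) - (l : Euc d))) ∧
  (∀ l : ↥X, Summable fun k : ↥X =>
    (∏ j : Fin d, (1 + |(k : Euc d) j - (l : Euc d) j|) ^ (α j)) *
      ‖A k l‖ * ν ((k : Euc d) - (l : Euc d))) ∧
  BddAbove (Set.range fun l : ↥X => ∑' k : ↥X,
    (∏ j : Fin d, (1 + |(k : Euc d) j - (l : Euc d) j|) ^ (α j)) *
      ‖A k l‖ * ν ((k : Euc d) - (l : Euc d)))

/-- The sequence `δ_l f ∈ ℓ^p(X;H)` equal to `f` at index `l` and `0` elsewhere. -/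
noncomputable def deltaSeq {X : Type*} {H : Type*} [NormedAddCommGroup H]
    (p : ℝ≥0∞) (l : X) (f : H) : lp (fun _ : X => H) p :=
  haveI := Classical.decEq X
  lp.single p l f

/-! ### Schur norms of nonnegative kernels -/

section Kernel

variable {ι : Type*}

/-- The largest row or column sum of a nonnegative kernel. -/
def schurNorm (a : ι → ι → ℝ≥0∞) : ℝ≥0∞ :=
  (⨆ k, ∑' l, a k l) ⊔ (⨆ l, ∑' k, a k l)

/-- The composition of two nonnegative kernels. -/
def kernelComp (a b : ι → ι → ℝ≥0∞) (k l : ι) : ℝ≥0∞ := ∑' p, a k p * b p l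

theorem schurNorm_le_iff {a : ι → ι → ℝ≥0∞} {C : ℝ≥0∞} :
    schurNorm a ≤ C ↔ (∀ k, ∑' l, a k l ≤ C) ∧ ∀ l, ∑' k, a k l ≤ C := by
  simp [schurNorm]

theorem row_le_schurNorm (a : ι → ι → ℝ≥0∞) (k : ι) : ∑' l, a k l ≤ schurNorm a :=
  (schurNorm_le_iff.1 le_rfl).1 k

theorem col_le_schurNorm (a : ι → ι → ℝ≥0∞) (l : ι) : ∑' k, a k l ≤ schurNorm a :=
  (schurNorm_le_iff.1 le_rfl).2 l

theorem schurNorm_swap (a : ι → ι → ℝ≥0∞) : schurNorm (fun k l => a l k) = schurNorm a :=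
  sup_comm _ _

theorem schurNorm_mono {a b : ι → ι → ℝ≥0∞} (h : ∀ k l, a k l ≤ b k l) :
    schurNorm a ≤ schurNorm b :=
  schurNorm_le_iff.2
    ⟨fun k => (ENNReal.tsum_le_tsum (h k)).trans (row_le_schurNorm b k),
      fun l => (ENNReal.tsum_le_tsum fun k => h k l).trans (col_le_schurNorm b l)⟩

theorem schurNorm_add_le (a b : ι → ι → ℝ≥0∞) :
    schurNorm (fun k l => a k l + b k l) ≤ schurNorm a + schurNorm b :=
  schurNorm_le_iff.2
    ⟨fun k => ENNReal.tsum_add.trans_le (add_le_add (row_le_schurNorm a k) (row_le_schurNorm b k)),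
      fun l => ENNReal.tsum_add.trans_le
        (add_le_add (col_le_schurNorm a l) (col_le_schurNorm b l))⟩

theorem schurNorm_const_mul_le (c : ℝ≥0∞) (a : ι → ι → ℝ≥0∞) :
    schurNorm (fun k l => c * a k l) ≤ c * schurNorm a :=
  schurNorm_le_iff.2
    ⟨fun k => ENNReal.tsum_mul_left.trans_le (mul_le_mul_right (row_le_schurNorm a k) c),
      fun l => ENNReal.tsum_mul_left.trans_le (mul_le_mul_right (col_le_schurNorm a l) c)⟩

theorem schurNorm_tsum_le {β : Type*} (a : β → ι → ι → ℝ≥0∞) :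
    schurNorm (fun k l => ∑' n, a n k l) ≤ ∑' n, schurNorm (a n) :=
  schurNorm_le_iff.2
    ⟨fun _ => ENNReal.tsum_comm.trans_le (ENNReal.tsum_le_tsum fun n => row_le_schurNorm (a n) _),
      fun _ => ENNReal.tsum_comm.trans_le
        (ENNReal.tsum_le_tsum fun n => col_le_schurNorm (a n) _)⟩

theorem tsum_kernelComp_le (a b : ι → ι → ℝ≥0∞) (k : ι) :
    ∑' l, kernelComp a b k l ≤ schurNorm a * schurNorm b :=
  calc ∑' l, kernelComp a b k l = ∑' p, a k p * ∑' l, b p l := by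
        simp only [kernelComp, ← ENNReal.tsum_mul_left]
        exact ENNReal.tsum_comm
    _ ≤ ∑' p, a k p * schurNorm b :=
        ENNReal.tsum_le_tsum fun p => mul_le_mul_right (row_le_schurNorm b p) _
    _ = (∑' p, a k p) * schurNorm b := ENNReal.tsum_mul_right
    _ ≤ schurNorm a * schurNorm b := mul_le_mul_left (row_le_schurNorm a k) _

theorem schurNorm_kernelComp_le (a b : ι → ι → ℝ≥0∞) :
    schurNorm (kernelComp a b) ≤ schurNorm a * schurNorm b := by
  refine schurNorm_le_iff.2 ⟨tsum_kernelComp_le a b, fun l => ?_⟩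
  have h := tsum_kernelComp_le (fun k l => b l k) (fun k l => a l k) l
  rw [schurNorm_swap a, schurNorm_swap b, mul_comm] at h
  exact (ENNReal.tsum_le_tsum fun k => ENNReal.tsum_le_tsum fun p => (mul_comm _ _).le).trans h

end Kernel

section Delta

variable {ι : Type*} {H : Type*} [NormedAddCommGroup H]

theorem deltaSeq_apply_self (l : ι) (f : H) : deltaSeq 2 l f l = f :=
  letI := Classical.decEq ι
  lp.single_apply_self (E := fun _ : ι => H) 2 l f

theorem deltaSeq_apply_ne {k l : ι} (h : k ≠ l) (f : H) : deltaSeq 2 l f k = 0 :=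
  letI := Classical.decEq ι
  lp.single_apply_ne (E := fun _ : ι => H) 2 l f h

theorem norm_deltaSeq (l : ι) (f : H) : ‖deltaSeq 2 l f‖ = ‖f‖ :=
  letI := Classical.decEq ι
  lp.norm_single (E := fun _ : ι => H) two_pos l f

theorem hasSum_deltaSeq (f : lp (fun _ : ι => H) 2) :
    HasSum (fun k => deltaSeq 2 k (f k)) f :=
  letI := Classical.decEq ι
  lp.hasSum_single ENNReal.ofNat_ne_top f

end Delta

/-! ### Matrix entries of bounded operators on `ℓ²(ι; H)` -/

section Entry

variable {ι : Type*} {H : Type*} [NormedAddCommGroup H] [InnerProductSpace ℂ H]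

/-- The canonical matrix entries of a bounded operator on `ℓ²(ι; H)`. -/
def entry (T : lp (fun _ : ι => H) 2 →L[ℂ] lp (fun _ : ι => H) 2) (k l : ι) : H →L[ℂ] H :=
  letI := Classical.decEq ι
  (lp.evalCLM ℂ (fun _ : ι => H) 2 k).comp
    (T.comp (lp.singleContinuousLinearMap ℂ (fun _ : ι => H) 2 l))

theorem entry_apply (T : lp (fun _ : ι => H) 2 →L[ℂ] lp (fun _ : ι => H) 2) (k l : ι) (f : H) :
    entry T k l f = T (deltaSeq 2 l f) k := rfl

theorem norm_entry_le (T : lp (fun _ : ι => H) 2 →L[ℂ] lp (fun _ : ι => H) 2) (k l : ι) :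
    ‖entry T k l‖ ≤ ‖T‖ :=
  ContinuousLinearMap.opNorm_le_bound _ (norm_nonneg T) fun f => by
    rw [entry_apply, ← norm_deltaSeq l f]
    exact (lp.norm_apply_le_norm two_ne_zero _ _).trans (T.le_opNorm _)

theorem entry_one_of_ne {k l : ι} (h : k ≠ l) :
    entry (1 : lp (fun _ : ι => H) 2 →L[ℂ] lp (fun _ : ι => H) 2) k l = 0 := by
  ext f
  simp [entry_apply, deltaSeq_apply_ne h]

theorem enorm_entry_one_of_ne {k l : ι} (h : k ≠ l) :
    ‖entry (1 : lp (fun _ : ι => H) 2 →L[ℂ] lp (fun _ : ι => H) 2) k l‖ₑ = 0 := by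
  rw [entry_one_of_ne h]
  exact enorm_zero (E := H →L[ℂ] H)

theorem enorm_entry_add_le (S T : lp (fun _ : ι => H) 2 →L[ℂ] lp (fun _ : ι => H) 2) (k l : ι) :
    ‖entry (S + T) k l‖ₑ ≤ ‖entry S k l‖ₑ + ‖entry T k l‖ₑ := by
  have : entry (S + T) k l = entry S k l + entry T k l := by
    ext f; simp [entry_apply]
  rw [this]
  exact enorm_add_le (entry S k l) (entry T k l)

theorem enorm_entry_smul (c : ℂ) (T : lp (fun _ : ι => H) 2 →L[ℂ] lp (fun _ : ι => H) 2)
    (k l : ι) : ‖entry (c • T) k l‖ₑ = ‖c‖ₑ * ‖entry T k l‖ₑ := by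
  have : entry (c • T) k l = c • entry T k l := by
    ext f; simp [entry_apply]
  rw [this, enorm_smul]

theorem enorm_entry_zero (k l : ι) :
    ‖entry (0 : lp (fun _ : ι => H) 2 →L[ℂ] lp (fun _ : ι => H) 2) k l‖ₑ = 0 := by
  simpa using enorm_entry_smul 0 (0 : lp (fun _ : ι => H) 2 →L[ℂ] lp (fun _ : ι => H) 2) k l

theorem entry_comp_hasSum (S T : lp (fun _ : ι => H) 2 →L[ℂ] lp (fun _ : ι => H) 2)
    (k l : ι) (f : H) :
    HasSum (fun p => entry S k p (entry T p l f)) (entry (S * T) k l f) :=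
  (hasSum_deltaSeq (T (deltaSeq 2 l f))).mapL
    ((lp.evalCLM ℂ (fun _ : ι => H) 2 k).comp S)

theorem enorm_entry_mul_le (S T : lp (fun _ : ι => H) 2 →L[ℂ] lp (fun _ : ι => H) 2) (k l : ι) :
    ‖entry (S * T) k l‖ₑ ≤
      kernelComp (fun k l => ‖entry S k l‖ₑ) (fun k l => ‖entry T k l‖ₑ) k l := by
  refine ContinuousLinearMap.opENorm_le_bound _ fun f => ?_
  rw [← (entry_comp_hasSum S T k l f).tsum_eq, kernelComp, ← ENNReal.tsum_mul_right]
  refine enorm_tsum_le_tsum_enorm.trans (ENNReal.tsum_le_tsum fun p => ?_)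
  rw [mul_assoc]
  exact ((entry S k p).le_opENorm _).trans (mul_le_mul_right ((entry T p l).le_opENorm f) _)

theorem enorm_entry_tsum_le {F : ℕ → lp (fun _ : ι => H) 2 →L[ℂ] lp (fun _ : ι => H) 2}
    (hF : Summable F) (k l : ι) :
    ‖entry (∑' n, F n) k l‖ₑ ≤ ∑' n, ‖entry (F n) k l‖ₑ := by
  refine ContinuousLinearMap.opENorm_le_bound _ fun f => ?_
  have h : HasSum (fun n => entry (F n) k l f) (entry (∑' n, F n) k l f) :=
    hF.hasSum.mapL ((lp.evalCLM ℂ (fun _ : ι => H) 2 k).comp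
      (ContinuousLinearMap.apply ℂ (lp (fun _ : ι => H) 2) (deltaSeq 2 l f)))
  rw [← h.tsum_eq, ← ENNReal.tsum_mul_right]
  exact enorm_tsum_le_tsum_enorm.trans
    (ENNReal.tsum_le_tsum fun n => (entry (F n) k l).le_opENorm f)

theorem inner_deltaSeq_left (l : ι) (f : H) (g : lp (fun _ : ι => H) 2) [CompleteSpace H] :
    inner ℂ (deltaSeq 2 l f) g = inner ℂ f (g l) :=
  letI := Classical.decEq ι
  lp.inner_single_left (𝕜 := ℂ) (G := fun _ : ι => H) l f g

theorem norm_entry_adjoint [CompleteSpace H]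
    (T : lp (fun _ : ι => H) 2 →L[ℂ] lp (fun _ : ι => H) 2) (k l : ι) :
    ‖entry (ContinuousLinearMap.adjoint T) k l‖ = ‖entry T l k‖ := by
  rw [← LinearIsometryEquiv.norm_map ContinuousLinearMap.adjoint (entry T l k)]
  congr 1
  rw [ContinuousLinearMap.eq_adjoint_iff]
  intro f g
  rw [← inner_conj_symm, entry_apply, ← inner_deltaSeq_left,
    ContinuousLinearMap.adjoint_inner_right, ← inner_conj_symm, inner_deltaSeq_left, entry_apply]
  simp

end Entry
/-! ### Counting points of relatively separated sets -/

theorem tsum_indicator_box_le {d N : ℕ} {X : Set (Euc d)}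
    (hN : ∀ x : Euc d, (X ∩ {y | ∀ j, x j ≤ y j ∧ y j ≤ x j + 1}).Finite ∧
      (X ∩ {y | ∀ j, x j ≤ y j ∧ y j ≤ x j + 1}).ncard ≤ N) (x : Euc d) :
    ∑' l : X, {l : X | ∀ j, x j ≤ (l : Euc d) j ∧ (l : Euc d) j ≤ x j + 1}.indicator
      (1 : X → ℝ≥0∞) l ≤ N := by
  set s : Set (Euc d) := {y | ∀ j, x j ≤ y j ∧ y j ≤ x j + 1} with hs
  change ∑' l : X, (Subtype.val ⁻¹' s).indicator (1 : X → ℝ≥0∞) l ≤ N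
  rw [← tsum_subtype]
  simp only [Pi.one_apply]
  rw [ENNReal.tsum_set_one, ← Subtype.val_injective.encard_image, Subtype.image_preimage_coe,
    ← (hN x).1.cast_ncard_eq]
  exact_mod_cast (hN x).2

theorem card_piFinset_Icc_le (d : ℕ) {L : ℝ} (hL : 1 ≤ L) :
    ((Fintype.piFinset fun _ : Fin d => Finset.Icc (-⌈L⌉) ⌈L⌉).card : ℝ) ≤ (5 * L) ^ d := by
  rw [Fintype.card_piFinset]
  simp only [Int.card_Icc, Finset.prod_const, Finset.card_univ, Fintype.card_fin, Nat.cast_pow]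
  refine pow_le_pow_left₀ (by positivity) ?_ d
  have h0 : 0 ≤ ⌈L⌉ + 1 - -⌈L⌉ := by
    have : 0 ≤ ⌈L⌉ := Int.ceil_nonneg (by linarith)
    linarith
  have h1 : (((⌈L⌉ + 1 - -⌈L⌉).toNat : ℤ) : ℝ) = 2 * (⌈L⌉ : ℝ) + 1 := by
    rw [Int.toNat_of_nonneg h0]
    push_cast
    ring
  have h2 := Int.ceil_lt_add_one L
  have h3 : (((⌈L⌉ + 1 - -⌈L⌉).toNat : ℕ) : ℝ) = 2 * (⌈L⌉ : ℝ) + 1 := by exact_mod_cast h1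
  rw [h3]
  linarith

theorem tsum_indicator_ball_le {d N : ℕ} {X : Set (Euc d)}
    (hN : ∀ x : Euc d, (X ∩ {y | ∀ j, x j ≤ y j ∧ y j ≤ x j + 1}).Finite ∧
      (X ∩ {y | ∀ j, x j ≤ y j ∧ y j ≤ x j + 1}).ncard ≤ N) (x : Euc d) {L : ℝ} (hL : 1 ≤ L) :
    ∑' l : X, {l : X | ‖x - l‖ ≤ L}.indicator (1 : X → ℝ≥0∞) l ≤
      ENNReal.ofReal ((5 * L) ^ d * N) := by
  set F := Fintype.piFinset fun _ : Fin d => Finset.Icc (-⌈L⌉) ⌈L⌉ with hF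
  let c (z : Fin d → ℤ) : Euc d := WithLp.toLp 2 fun j => x j + z j
  let Q (z : Fin d → ℤ) : Set X :=
    {l : X | ∀ j, c z j ≤ (l : Euc d) j ∧ (l : Euc d) j ≤ c z j + 1}
  calc ∑' l : X, {l : X | ‖x - l‖ ≤ L}.indicator (1 : X → ℝ≥0∞) l
      ≤ ∑' l : X, ∑ z ∈ F, (Q z).indicator (1 : X → ℝ≥0∞) l := by
        refine ENNReal.tsum_le_tsum fun l => ?_
        refine Set.indicator_apply_le' (fun hl => ?_) fun _ => bot_le
        let z : Fin d → ℤ := fun j => ⌊(l : Euc d) j - x j⌋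
        have hz : z ∈ F := by
          refine Fintype.mem_piFinset.2 fun j => Finset.mem_Icc.2 ?_
          have hj : |x j - (l : Euc d) j| ≤ L := by
            have := PiLp.norm_apply_le (x - (l : Euc d)) j
            rw [PiLp.sub_apply, Real.norm_eq_abs] at this
            exact this.trans hl
          rw [abs_le] at hj
          have hc := Int.le_ceil L
          refine ⟨Int.le_floor.2 ?_, Int.cast_le.1 ((Int.floor_le _).trans (a := (z j : ℝ)) ?_)⟩
          · push_cast
            linarith
          · linarith
        have hlz : l ∈ Q z := by
          intro j
          have h1 := Int.floor_le ((l : Euc d) j - x j)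
          have h2 := Int.lt_floor_add_one ((l : Euc d) j - x j)
          change x j + (z j : ℝ) ≤ _ ∧ _ ≤ x j + (z j : ℝ) + 1
          constructor <;> linarith
        calc (1 : X → ℝ≥0∞) l = (Q z).indicator (1 : X → ℝ≥0∞) l := by
              rw [Set.indicator_of_mem hlz]
          _ ≤ _ := Finset.single_le_sum (f := fun z => (Q z).indicator (1 : X → ℝ≥0∞) l)
              (fun _ _ => bot_le) hz
    _ = ∑ z ∈ F, ∑' l : X, (Q z).indicator (1 : X → ℝ≥0∞) l :=
        Summable.tsum_finsetSum fun _ _ => ENNReal.summable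
    _ ≤ ∑ _z ∈ F, (N : ℝ≥0∞) := Finset.sum_le_sum fun z _ => tsum_indicator_box_le hN (c z)
    _ = ENNReal.ofReal ((F.card : ℝ) * N) := by
        rw [Finset.sum_const, nsmul_eq_mul, ENNReal.ofReal_mul (by positivity),
          ENNReal.ofReal_natCast, ENNReal.ofReal_natCast]
    _ ≤ ENNReal.ofReal ((5 * L) ^ d * N) :=
        ENNReal.ofReal_le_ofReal
          (mul_le_mul_of_nonneg_right (card_piFinset_Icc_le d hL) (Nat.cast_nonneg N))

/-! ### Weighted Schur norms of bounded operators -/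

section WeightedNorm

variable {d : ℕ} {X : Set (Euc d)} {H : Type*} [NormedAddCommGroup H] [InnerProductSpace ℂ H]

/-- The Schur norm, with weight `w`, of the canonical matrix of a bounded operator. -/
def wNorm (w : Euc d → ℝ) (T : lp (fun _ : X => H) 2 →L[ℂ] lp (fun _ : X => H) 2) : ℝ≥0∞ :=
  schurNorm fun k l : X => ‖entry T k l‖ₑ * ENNReal.ofReal (w (k - l))

variable {w u v : Euc d → ℝ} (S T : lp (fun _ : X => H) 2 →L[ℂ] lp (fun _ : X => H) 2)

theorem wNorm_le_add {a b : ℝ} (ha : 0 ≤ a) (hb : 0 ≤ b)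
    (h : ∀ x, w x ≤ a * u x + b * v x) :
    wNorm w T ≤ ENNReal.ofReal a * wNorm u T + ENNReal.ofReal b * wNorm v T := by
  refine (schurNorm_mono fun k l => ?_).trans ((schurNorm_add_le _ _).trans
    (add_le_add (schurNorm_const_mul_le _ _) (schurNorm_const_mul_le _ _)))
  calc ‖entry T k l‖ₑ * ENNReal.ofReal (w (k - l))
      ≤ ‖entry T k l‖ₑ * (ENNReal.ofReal a * ENNReal.ofReal (u (k - l)) +
          ENNReal.ofReal b * ENNReal.ofReal (v (k - l))) := by
        rw [← ENNReal.ofReal_mul ha, ← ENNReal.ofReal_mul hb]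
        gcongr
        exact (ENNReal.ofReal_le_ofReal (h _)).trans ENNReal.ofReal_add_le
    _ = _ := by ring

theorem wNorm_le_mul {a : ℝ} (ha : 0 ≤ a) (h : ∀ x, w x ≤ a * u x) :
    wNorm w T ≤ ENNReal.ofReal a * wNorm u T := by
  simpa using wNorm_le_add (v := u) T ha le_rfl (fun x => by simpa using h x)

theorem wNorm_mono (h : ∀ x, w x ≤ u x) : wNorm w T ≤ wNorm u T := by
  simpa using wNorm_le_mul T zero_le_one (fun x => by simpa using h x)

theorem wNorm_mul_le_add {w₁ w₂ : Euc d → ℝ} (hw₁ : ∀ x, 0 ≤ w₁ x) (hw₂ : ∀ x, 0 ≤ w₂ x)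
    (h : ∀ x y, w (x + y) ≤ w₁ x * u y + w₂ x * v y) :
    wNorm w (S * T) ≤ wNorm w₁ S * wNorm u T + wNorm w₂ S * wNorm v T := by
  refine (schurNorm_mono fun k l => ?_).trans ((schurNorm_add_le _ _).trans
    (add_le_add (schurNorm_kernelComp_le _ _) (schurNorm_kernelComp_le _ _)))
  simp only [kernelComp]
  rw [← ENNReal.tsum_add]
  refine (mul_le_mul_left (enorm_entry_mul_le S T k l) _).trans ?_
  rw [kernelComp, ← ENNReal.tsum_mul_right]
  refine ENNReal.tsum_le_tsum fun p => ?_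
  calc ‖entry S k p‖ₑ * ‖entry T p l‖ₑ * ENNReal.ofReal (w (k - l))
      ≤ ‖entry S k p‖ₑ * ‖entry T p l‖ₑ *
        (ENNReal.ofReal (w₁ (k - p)) * ENNReal.ofReal (u (p - l)) +
          ENNReal.ofReal (w₂ (k - p)) * ENNReal.ofReal (v (p - l))) := by
        rw [← ENNReal.ofReal_mul (hw₁ _), ← ENNReal.ofReal_mul (hw₂ _)]
        gcongr
        refine (ENNReal.ofReal_le_ofReal ?_).trans ENNReal.ofReal_add_le
        simpa using h ((k : Euc d) - p) (p - l)
    _ = _ := by ring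

theorem wNorm_mul_le (hw : ∀ x, 0 ≤ w x) (h : ∀ x y, w (x + y) ≤ w x * w y) :
    wNorm w (S * T) ≤ wNorm w S * wNorm w T := by
  have := wNorm_mul_le_add (v := fun _ => 0) (w₂ := fun _ => 0) S T hw (fun _ => le_rfl)
    (fun x y => by simpa using h x y)
  simpa [wNorm, schurNorm] using this

theorem wNorm_add_le : wNorm w (S + T) ≤ wNorm w S + wNorm w T :=
  (schurNorm_mono fun k l => (mul_le_mul_left (enorm_entry_add_le S T k l) _).trans_eq
    (add_mul _ _ _)).trans (schurNorm_add_le _ _)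

theorem wNorm_smul_le (c : ℂ) : wNorm w (c • T) ≤ ‖c‖ₑ * wNorm w T :=
  (schurNorm_mono fun k l => by rw [enorm_entry_smul, mul_assoc]).trans
    (schurNorm_const_mul_le _ _)

theorem wNorm_one_le :
    wNorm w (1 : lp (fun _ : X => H) 2 →L[ℂ] lp (fun _ : X => H) 2) ≤
      ‖(1 : lp (fun _ : X => H) 2 →L[ℂ] lp (fun _ : X => H) 2)‖ₑ * ENNReal.ofReal (w 0) := by
  have h : ∀ k : X, ‖entry (1 : lp (fun _ : X => H) 2 →L[ℂ] lp (fun _ : X => H) 2) k k‖ₑ *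
      ENNReal.ofReal (w (k - k)) ≤
      ‖(1 : lp (fun _ : X => H) 2 →L[ℂ] lp (fun _ : X => H) 2)‖ₑ * ENNReal.ofReal (w 0) := by
    intro k
    rw [sub_self]
    gcongr
    exact enorm_le_iff_norm_le.2 (norm_entry_le _ k k)
  refine schurNorm_le_iff.2 ⟨fun k => ?_, fun k => ?_⟩
  · rw [tsum_eq_single k fun l hl => by rw [enorm_entry_one_of_ne hl.symm, zero_mul]]
    exact h k
  · rw [tsum_eq_single k fun l hl => by rw [enorm_entry_one_of_ne hl, zero_mul]]
    exact h k

theorem wNorm_adjoint [CompleteSpace H] (hw : ∀ x, w (-x) = w x) :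
    wNorm w (ContinuousLinearMap.adjoint T) = wNorm w T := by
  rw [wNorm, wNorm, ← schurNorm_swap]
  congr 1
  ext k l
  have h : ‖entry (ContinuousLinearMap.adjoint T) l k‖ₑ = ‖entry T k l‖ₑ := by
    rw [← ofReal_norm, norm_entry_adjoint, ofReal_norm]
  rw [h, ← hw, neg_sub]

theorem wNorm_tsum_le {F : ℕ → lp (fun _ : X => H) 2 →L[ℂ] lp (fun _ : X => H) 2}
    (hF : Summable F) : wNorm w (∑' n, F n) ≤ ∑' n, wNorm w (F n) :=
  (schurNorm_mono fun k l => (mul_le_mul_left (enorm_entry_tsum_le hF k l) _).trans_eq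
    ENNReal.tsum_mul_right.symm).trans (schurNorm_tsum_le _)

theorem wNorm_sum_lt_top {s : Finset ℕ}
    {F : ℕ → lp (fun _ : X => H) 2 →L[ℂ] lp (fun _ : X => H) 2}
    (hF : ∀ n ∈ s, wNorm w (F n) < ∞) : wNorm w (∑ n ∈ s, F n) < ∞ := by
  classical
  induction s using Finset.induction_on with
  | empty => simp [wNorm, schurNorm, enorm_entry_zero]
  | insert a s ha ih =>
    rw [Finset.sum_insert ha]
    exact (wNorm_add_le _ _).trans_lt (ENNReal.add_lt_top.2 ⟨hF a (Finset.mem_insert_self a s),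
      ih fun n hn => hF n (Finset.mem_insert_of_mem hn)⟩)

theorem wNorm_pow_succ_le (hw : ∀ x, 0 ≤ w x) (h : ∀ x y, w (x + y) ≤ w x * w y) (n : ℕ) :
    wNorm w (T ^ (n + 1)) ≤ wNorm w T ^ (n + 1) := by
  induction n with
  | zero => simp
  | succ n ih =>
    rw [pow_succ T, pow_succ (wNorm w T)]
    exact (wNorm_mul_le _ _ hw h).trans (mul_le_mul_left ih _)

theorem wNorm_pow_lt_top (hw : ∀ x, 0 ≤ w x) (h : ∀ x y, w (x + y) ≤ w x * w y)
    (hT : wNorm w T < ∞) (n : ℕ) : wNorm w (T ^ n) < ∞ := by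
  cases n with
  | zero => exact wNorm_one_le.trans_lt (ENNReal.mul_lt_top enorm_lt_top ENNReal.ofReal_lt_top)
  | succ n => exact (wNorm_pow_succ_le T hw h n).trans_lt (ENNReal.pow_lt_top hT)

theorem wNorm_one_le_near_add_far {N : ℕ}
    (hN : ∀ x : Euc d, (X ∩ {y | ∀ j, x j ≤ y j ∧ y j ≤ x j + 1}).Finite ∧
      (X ∩ {y | ∀ j, x j ≤ y j ∧ y j ≤ x j + 1}).ncard ≤ N)
    {δ : ℝ} (hδ : 0 ≤ δ) {L : ℝ} (hL : 1 ≤ L) :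
    wNorm (fun _ => 1) T ≤ ENNReal.ofReal ((5 * L) ^ d * N * ‖T‖) +
      ENNReal.ofReal (L ^ (-δ)) * wNorm (fun x => (1 + ‖x‖) ^ δ) T := by
  have hL0 : 0 < L := by linarith
  have hpt : ∀ k l : X, ‖entry T k l‖ₑ * ENNReal.ofReal 1 ≤
      ‖T‖ₑ * {y : Euc d | ‖y‖ ≤ L}.indicator (1 : Euc d → ℝ≥0∞) (k - l) +
      ENNReal.ofReal (L ^ (-δ)) *
        (‖entry T k l‖ₑ * ENNReal.ofReal ((1 + ‖(k : Euc d) - l‖) ^ δ)) := by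
    intro k l
    rw [ENNReal.ofReal_one, mul_one]
    by_cases hkl : ‖(k : Euc d) - l‖ ≤ L
    · rw [Set.indicator_of_mem (by exact hkl), Pi.one_apply, mul_one]
      exact (enorm_le_iff_norm_le.2 (norm_entry_le _ k l)).trans le_self_add
    · rw [mul_left_comm, ← ENNReal.ofReal_mul (by positivity)]
      refine le_add_left (le_mul_of_one_le_right zero_le ?_)
      rw [ENNReal.one_le_ofReal, Real.rpow_neg hL0.le, ← div_eq_inv_mul,
        one_le_div (by positivity)]
      exact Real.rpow_le_rpow hL0.le (by linarith [not_le.1 hkl]) hδ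
  refine (schurNorm_mono hpt).trans ((schurNorm_add_le _ _).trans
    (add_le_add ((schurNorm_const_mul_le _ _).trans ?_) (schurNorm_const_mul_le _ _)))
  rw [mul_comm, ENNReal.ofReal_mul (by positivity), ofReal_norm T]
  gcongr
  refine schurNorm_le_iff.2 ⟨fun k => tsum_indicator_ball_le hN k hL, fun l => ?_⟩
  refine le_trans (ENNReal.tsum_le_tsum fun k => ?_) (tsum_indicator_ball_le hN l hL)
  simp only [Set.indicator, Set.mem_ofPred_eq, norm_sub_rev (l : Euc d), Pi.one_apply, le_refl]

end WeightedNorm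
/-! ### Concave functions on the half-line -/

section Concave

variable {ρ : ℝ → ℝ}

theorem ConcaveOn.secant_shift_le (hρ : ConcaveOn ℝ (Set.Ici 0) ρ) {a h c k : ℝ} (ha : 0 ≤ a)
    (hh : 0 ≤ h) (hk : 0 ≤ k) (hac : a ≤ c) (hle : a + h ≤ c + k) :
    (ρ (c + k) - ρ c) * h ≤ (ρ (a + h) - ρ a) * k := by
  rcases hh.eq_or_lt with rfl | hh
  · simp
  rcases hk.eq_or_lt with rfl | hk
  · simp
  have hc : 0 ≤ c := ha.trans hac
  have h1 := hρ.neg.secant_mono (a := a) (x := a + h) (y := c + k) ha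
    (Set.mem_Ici.2 (by linarith)) (Set.mem_Ici.2 (by linarith)) (by linarith)
    (by linarith) hle
  have h2 := hρ.neg.secant_mono (a := c + k) (x := a) (y := c)
    (Set.mem_Ici.2 (by linarith)) ha hc (by linarith) (by linarith) hac
  simp only [Pi.neg_apply, add_sub_cancel_left] at h1 h2
  have h3 : (-ρ (c + k) - -ρ a) / (c + k - a) = (-ρ a - -ρ (c + k)) / (a - (c + k)) := by
    rw [← neg_div_neg_eq]
    congr 1 <;> ring
  have h4 : (-ρ c - -ρ (c + k)) / (c - (c + k)) = (-ρ (c + k) - -ρ c) / k := by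
    rw [← neg_div_neg_eq]
    congr 1 <;> ring
  rw [h3] at h1
  rw [h4] at h2
  have h5 := h1.trans h2
  rw [div_le_div_iff₀ hh hk] at h5
  linarith

theorem ConcaveOn.monotoneOn_of_nonneg (hρ : ConcaveOn ℝ (Set.Ici 0) ρ)
    (h0 : ∀ t ∈ Set.Ici (0 : ℝ), 0 ≤ ρ t) : MonotoneOn ρ (Set.Ici 0) := by
  intro s hs t ht hst
  by_contra! hlt
  have hs : 0 ≤ s := hs
  have ht : 0 ≤ t := ht
  set k := (ρ t * (t - s) + 1) / (ρ s - ρ t) with hk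
  have hpos : 0 < ρ s - ρ t := by linarith
  have hk0 : 0 < k := by
    have := mul_nonneg (h0 t ht) (sub_nonneg.2 hst)
    positivity
  have h1 := hρ.secant_shift_le (a := s) (h := t - s) (c := t) (k := k) hs (by linarith)
    hk0.le hst (by linarith)
  have h2 : (ρ s - ρ t) * k = ρ t * (t - s) + 1 := by
    rw [hk]; field_simp
  have h3 := mul_nonneg (h0 (t + k) (Set.mem_Ici.2 (by linarith))) (sub_nonneg.2 hst)
  rw [add_sub_cancel] at h1
  linarith

theorem ConcaveOn.exists_shift_le (hρ : ConcaveOn ℝ (Set.Ici 0) ρ) (h00 : ρ 0 = 0)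
    (hsub : ∀ ε > 0, ∃ N > 0, ρ N ≤ ε * N) {ε : ℝ} (hε : 0 < ε) :
    ∃ N > 0, ∀ t, 0 ≤ t → ρ (t + N) - ρ N ≤ ε * t := by
  obtain ⟨N, hN, hρN⟩ := hsub ε hε
  refine ⟨N, hN, fun t ht => ?_⟩
  have h1 := hρ.secant_shift_le (a := 0) (h := N) (c := N) (k := t) le_rfl hN.le ht hN.le
    (by linarith)
  rw [zero_add, h00, sub_zero, add_comm N t] at h1
  have h2 := mul_le_mul_of_nonneg_right hρN ht
  exact le_of_mul_le_mul_right (by linarith) hN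

theorem ConcaveOn.exists_forall_doubling_le (hρ : ConcaveOn ℝ (Set.Ici 0) ρ) (h00 : ρ 0 = 0)
    (hsub : ∀ ε > 0, ∃ N > 0, ρ N ≤ ε * N)
    (hunb : ∀ K, ∃ t, 0 ≤ t ∧ K ≤ ρ t) (K : ℝ) :
    ∃ S, 0 < S ∧ ∀ s, S ≤ s → ρ (2 * s) - ρ s ≤ ρ s - K := by
  obtain ⟨S, hS, hgS⟩ : ∃ S, 0 < S ∧ K ≤ 2 * ρ S - ρ (2 * S) := by
    by_contra! hcon
    obtain ⟨t, ht, hρt⟩ := hunb (max K 0 + 1)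
    have hK := le_max_left K 0
    have hK0 := le_max_right K 0
    have ht : 0 < t := lt_of_le_of_ne ht (by rintro rfl; linarith)
    have hgrow : ∀ n : ℕ, 2 ^ n ≤ ρ (2 ^ n * t) - K := by
      intro n
      induction n with
      | zero => simp; linarith
      | succ n ih =>
        have := hcon (2 ^ n * t) (by positivity)
        rw [pow_succ, mul_comm (2 ^ n : ℝ) 2, mul_assoc]
        linarith
    obtain ⟨N, hN, hbound⟩ := hρ.exists_shift_le h00 hsub (ε := 1 / (2 * t)) (by positivity)
    obtain ⟨n, hn⟩ := pow_unbounded_of_one_lt (max (N / t) (2 * (ρ N - K) + 1)) one_lt_two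
    have hn1 : N ≤ 2 ^ n * t := by
      rw [← div_le_iff₀ ht]; exact (le_max_left _ _).trans hn.le
    have hn2 : 2 * (ρ N - K) + 1 ≤ 2 ^ n := (le_max_right _ _).trans hn.le
    have h1 := hbound (2 ^ n * t - N) (by linarith)
    rw [sub_add_cancel] at h1
    have h2 : 1 / (2 * t) * (2 ^ n * t - N) ≤ 2 ^ n / 2 := by
      have : 1 / (2 * t) * (2 ^ n * t - N) = 2 ^ n / 2 - N / (2 * t) := by field_simp
      have h3 : 0 ≤ N / (2 * t) := by positivity
      linarith
    linarith [hgrow n]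
  refine ⟨S, hS, fun s hs => ?_⟩
  rcases hs.eq_or_lt with rfl | hlt
  · linarith
  have h1 := hρ.secant_shift_le (a := S) (h := s - S) (c := 2 * S) (k := 2 * (s - S)) hS.le
    (by linarith) (by linarith) (by linarith) (by linarith)
  rw [show 2 * S + 2 * (s - S) = 2 * s by ring, add_sub_cancel] at h1
  have h2 : ρ (2 * s) - ρ (2 * S) ≤ 2 * (ρ s - ρ S) :=
    le_of_mul_le_mul_right (by linarith) (sub_pos.2 hlt)
  linarith

/-- The running maximum of the dyadic increments of `ρ (· + N)`. -/
def dyadicIncr (ρ : ℝ → ℝ) (N t : ℝ) : ℝ :=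
  sSup ((fun s => ρ (2 * s + N) - ρ (s + N)) '' Set.Icc 0 t)

theorem ConcaveOn.dyadic_le (hρ : ConcaveOn ℝ (Set.Ici 0) ρ) {a s N : ℝ} (ha : 0 ≤ a)
    (haN : a ≤ N) (hs : 0 ≤ s) :
    ρ (2 * s + N) - ρ (s + N) ≤ ρ (s + a) - ρ a := by
  rcases hs.eq_or_lt with rfl | hs
  · simp
  have h1 := hρ.secant_shift_le (a := a) (h := s) (c := s + N) (k := s) ha hs.le hs.le
    (by linarith) (by linarith)
  rw [show s + N + s = 2 * s + N by ring, add_comm a s] at h1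
  exact le_of_mul_le_mul_right h1 hs

theorem dyadicIncr_le {N t C : ℝ} (ht : 0 ≤ t)
    (h : ∀ s, 0 ≤ s → s ≤ t → ρ (2 * s + N) - ρ (s + N) ≤ C) : dyadicIncr ρ N t ≤ C :=
  csSup_le ⟨_, Set.mem_image_of_mem _ (Set.left_mem_Icc.2 ht)⟩
    (Set.forall_mem_image.2 fun s hs => h s hs.1 hs.2)

theorem ConcaveOn.le_dyadicIncr (hρ : ConcaveOn ℝ (Set.Ici 0) ρ)
    (h0 : ∀ t ∈ Set.Ici (0 : ℝ), 0 ≤ ρ t) {N s t : ℝ} (hN : 0 ≤ N) (hs : 0 ≤ s) (hst : s ≤ t) :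
    ρ (2 * s + N) - ρ (s + N) ≤ dyadicIncr ρ N t := by
  refine le_csSup ⟨ρ t - ρ 0, Set.forall_mem_image.2 fun r hr => ?_⟩
    (Set.mem_image_of_mem _ ⟨hs, hst⟩)
  have h1 := hρ.dyadic_le le_rfl hN hr.1
  rw [add_zero] at h1
  have h2 := hρ.monotoneOn_of_nonneg h0 hr.1 (hr.1.trans hr.2) hr.2
  linarith

theorem ConcaveOn.dyadicIncr_mono (hρ : ConcaveOn ℝ (Set.Ici 0) ρ)
    (h0 : ∀ t ∈ Set.Ici (0 : ℝ), 0 ≤ ρ t) {N s t : ℝ} (hN : 0 ≤ N) (hs : 0 ≤ s) (hst : s ≤ t) :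
    dyadicIncr ρ N s ≤ dyadicIncr ρ N t :=
  dyadicIncr_le hs fun _ hr hrs => hρ.le_dyadicIncr h0 hN hr (hrs.trans hst)

theorem ConcaveOn.dyadicIncr_le_shift (hρ : ConcaveOn ℝ (Set.Ici 0) ρ)
    (h0 : ∀ t ∈ Set.Ici (0 : ℝ), 0 ≤ ρ t) {N t : ℝ} (hN : 0 ≤ N) (ht : 0 ≤ t) :
    dyadicIncr ρ N t ≤ ρ (t + N) - ρ N :=
  dyadicIncr_le ht fun s hs hst => (hρ.dyadic_le hN le_rfl hs).trans <| sub_le_sub_right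
    (hρ.monotoneOn_of_nonneg h0 (Set.mem_Ici.2 (by linarith)) (Set.mem_Ici.2 (by linarith))
      (by linarith)) _

theorem ConcaveOn.dyadic_subadditive (hρ : ConcaveOn ℝ (Set.Ici 0) ρ) {N a b : ℝ} (hN : 0 ≤ N)
    (ha : 0 ≤ a) (hb : 0 ≤ b) :
    ρ (2 * (a + b) + N) - ρ (a + b + N) ≤
      (ρ (2 * a + N) - ρ (a + N)) + (ρ (2 * b + N) - ρ (b + N)) := by
  have key : ∀ s t : ℝ, 0 ≤ s → s ≤ t →
      (ρ (2 * t + N) - ρ (t + N)) * s ≤ (ρ (2 * s + N) - ρ (s + N)) * t := by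
    intro s t hs hst
    have h1 := hρ.secant_shift_le (a := s + N) (h := s) (c := t + N) (k := t) (by linarith) hs
      (by linarith) (by linarith) (by linarith)
    rwa [show t + N + t = 2 * t + N by ring, show s + N + s = 2 * s + N by ring] at h1
  rcases (add_nonneg ha hb).eq_or_lt with h | h
  · obtain rfl : a = 0 := by linarith
    obtain rfl : b = 0 := by linarith
    simp
  · have h1 := key a (a + b) ha (by linarith)
    have h2 := key b (a + b) hb (by linarith)
    refine le_of_mul_le_mul_right ?_ h
    linarith

theorem ConcaveOn.dyadicIncr_subadditive (hρ : ConcaveOn ℝ (Set.Ici 0) ρ)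
    (h0 : ∀ t ∈ Set.Ici (0 : ℝ), 0 ≤ ρ t) {N a b : ℝ} (hN : 0 ≤ N) (ha : 0 ≤ a) (hb : 0 ≤ b) :
    dyadicIncr ρ N (a + b) ≤ dyadicIncr ρ N a + dyadicIncr ρ N b := by
  refine dyadicIncr_le (add_nonneg ha hb) fun s hs hsab => ?_
  have h1 := hρ.dyadic_subadditive hN (le_min hs ha) (sub_nonneg.2 (min_le_left s a))
  rw [add_sub_cancel] at h1
  refine h1.trans (add_le_add (hρ.le_dyadicIncr h0 hN (le_min hs ha) (min_le_right s a))
    (hρ.le_dyadicIncr h0 hN (sub_nonneg.2 (min_le_left s a)) ?_))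
  rcases le_total s a with h | h
  · rw [min_eq_left h]; linarith
  · rw [min_eq_right h]; linarith

theorem ConcaveOn.add_le_add_dyadicIncr (hρ : ConcaveOn ℝ (Set.Ici 0) ρ)
    (h0 : ∀ t ∈ Set.Ici (0 : ℝ), 0 ≤ ρ t) {N a b : ℝ} (hN : 0 ≤ N) (hb : 0 ≤ b) (hba : b ≤ a) :
    ρ (a + b + N) ≤ ρ (a + N) + dyadicIncr ρ N b := by
  have h1 := hρ.le_dyadicIncr h0 hN hb le_rfl
  rcases hb.eq_or_lt with rfl | hb
  · simp at h1 ⊢; linarith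
  have h2 := hρ.secant_shift_le (a := b + N) (h := b) (c := a + N) (k := b) (by linarith) hb.le
    hb.le (by linarith) (by linarith)
  rw [show a + N + b = a + b + N by ring, show b + N + b = 2 * b + N by ring] at h2
  linarith [le_of_mul_le_mul_right h2 hb]

theorem ConcaveOn.exists_forall_dyadicIncr_le (hρ : ConcaveOn ℝ (Set.Ici 0) ρ) (h00 : ρ 0 = 0)
    (h0 : ∀ t ∈ Set.Ici (0 : ℝ), 0 ≤ ρ t) (hsub : ∀ ε > 0, ∃ N > 0, ρ N ≤ ε * N)
    (hunb : ∀ K, ∃ t, 0 ≤ t ∧ K ≤ ρ t) (K : ℝ) :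
    ∃ L, 0 ≤ L ∧ ∀ t, L ≤ t → ∀ N, 0 ≤ N → dyadicIncr ρ N t ≤ ρ t - K := by
  obtain ⟨S, hS, hgain⟩ := hρ.exists_forall_doubling_le h00 hsub hunb K
  obtain ⟨L, hL, hρL⟩ := hunb (ρ S + K)
  have hmono := hρ.monotoneOn_of_nonneg h0
  refine ⟨L, hL, fun t ht N hN => dyadicIncr_le (hL.trans ht) fun s hs hst => ?_⟩
  have hLt := hmono hL (hL.trans ht) ht
  rcases le_total S s with h | h
  · have h1 := hmono hs (hL.trans ht) hst
    have h3 := hρ.secant_shift_le (a := s) (h := s) (c := s + N) (k := s) hs hs hs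
      (by linarith) (by linarith)
    rw [show s + N + s = 2 * s + N by ring, ← two_mul] at h3
    have h4 := le_of_mul_le_mul_right h3 (hS.trans_le h)
    linarith [hgain s h]
  · have h1 := hρ.dyadic_le le_rfl hN hs
    rw [add_zero, h00] at h1
    have h2 := hmono hs hS.le h
    linarith

end Concave
/-! ### Weights on `ℝ^d` -/

section Weights

variable {d : ℕ}

/-- The anisotropic polynomial weight `∏ⱼ (1 + ε |xⱼ|)^{αⱼ}`. -/
def polyWeight (α : Fin d → ℕ) (ε : ℝ) (x : Euc d) : ℝ := ∏ j, (1 + ε * |x j|) ^ α j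

theorem one_le_polyWeight (α : Fin d → ℕ) {ε : ℝ} (hε : 0 ≤ ε) (x : Euc d) :
    1 ≤ polyWeight α ε x :=
  Finset.prod_induction _ (1 ≤ ·) (fun _ _ => one_le_mul_of_one_le_of_one_le) le_rfl
    fun _ _ => one_le_pow₀ (le_add_of_nonneg_right (by positivity))

theorem polyWeight_add_le (α : Fin d → ℕ) {ε : ℝ} (hε : 0 ≤ ε) (x y : Euc d) :
    polyWeight α ε (x + y) ≤ polyWeight α ε x * polyWeight α ε y := by
  rw [polyWeight, polyWeight, polyWeight, ← Finset.prod_mul_distrib]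
  refine Finset.prod_le_prod (fun j _ => by positivity) fun j _ => ?_
  rw [← mul_pow]
  refine pow_le_pow_left₀ (by positivity) ?_ _
  have h1 : |(x + y) j| ≤ |x j| + |y j| := by
    rw [PiLp.add_apply]; exact abs_add_le _ _
  have h2 := mul_le_mul_of_nonneg_left h1 hε
  have h3 : 0 ≤ (ε * |x j|) * (ε * |y j|) := by positivity
  nlinarith

theorem polyWeight_mono (α : Fin d → ℕ) {ε ε' : ℝ} (hε : 0 ≤ ε) (h : ε ≤ ε') (x : Euc d) :
    polyWeight α ε x ≤ polyWeight α ε' x :=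
  Finset.prod_le_prod (fun j _ => by positivity) fun j _ =>
    pow_le_pow_left₀ (by positivity) (by gcongr) _

theorem polyWeight_one_le (α : Fin d → ℕ) {ε : ℝ} (hε : 0 < ε) (hε1 : ε ≤ 1) (x : Euc d) :
    polyWeight α 1 x ≤ (∏ j, ε⁻¹ ^ α j) * polyWeight α ε x := by
  rw [polyWeight, polyWeight, ← Finset.prod_mul_distrib]
  refine Finset.prod_le_prod (fun j _ => by positivity) fun j _ => ?_
  rw [← mul_pow]
  refine pow_le_pow_left₀ (by positivity) ?_ _
  rw [mul_add, mul_one, inv_mul_cancel_left₀ hε.ne', one_mul]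
  gcongr
  exact (one_le_inv₀ hε).2 hε1

theorem polyWeight_neg (α : Fin d → ℕ) (ε : ℝ) (x : Euc d) :
    polyWeight α ε (-x) = polyWeight α ε x := by
  simp [polyWeight]

theorem exists_polyWeight_le_two (α : Fin d → ℕ) (M : ℝ) :
    ∃ ε, 0 < ε ∧ ε ≤ 1 ∧ ∀ x : Euc d, ‖x‖ ≤ M → polyWeight α ε x ≤ 2 := by
  have hcont : Continuous fun ε : ℝ => ∏ j, (1 + ε * M) ^ α j := by fun_prop
  have hev : ∀ᶠ ε in nhds (0 : ℝ), ∏ j, (1 + ε * M) ^ α j < 2 :=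
    hcont.continuousAt.eventually_lt_const (by simp)
  obtain ⟨r, hr, hball⟩ := Metric.eventually_nhds_iff.1 hev
  refine ⟨min (r / 2) 1, by positivity, min_le_right _ _, fun x hx => ?_⟩
  have hr0 : 0 ≤ min (r / 2) 1 := by positivity
  refine le_trans ?_ (hball (y := min (r / 2) 1) ?_).le
  · refine Finset.prod_le_prod (fun j _ => by positivity) fun j _ =>
      pow_le_pow_left₀ (by positivity) ?_ _
    gcongr
    exact (PiLp.norm_apply_le x j).trans hx
  · rw [Real.dist_eq, sub_zero, abs_of_nonneg hr0]
    exact (min_le_left _ _).trans_lt (by linarith)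

theorem one_add_norm_rpow_subadditive {δ : ℝ} (hδ0 : 0 ≤ δ) (hδ1 : δ ≤ 1) (x y : Euc d) :
    (1 + ‖x + y‖) ^ δ ≤ (1 + ‖x‖) ^ δ + (1 + ‖y‖) ^ δ := by
  refine le_trans (Real.rpow_le_rpow (by positivity) ?_ hδ0)
    (Real.rpow_add_le_add_rpow (by positivity) (by positivity) hδ0 hδ1)
  linarith [norm_add_le x y]

theorem one_add_norm_rpow_submultiplicative {δ : ℝ} (hδ0 : 0 ≤ δ) (x y : Euc d) :
    (1 + ‖x + y‖) ^ δ ≤ (1 + ‖x‖) ^ δ * (1 + ‖y‖) ^ δ := by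
  rw [← Real.mul_rpow (by positivity) (by positivity)]
  refine Real.rpow_le_rpow (by positivity) ?_ hδ0
  nlinarith [norm_add_le x y, mul_nonneg (norm_nonneg x) (norm_nonneg y)]

theorem Admissible.neg {ν : Euc d → ℝ} (hν : Admissible ν) (x : Euc d) : ν (-x) = ν x := by
  obtain ⟨⟨ρ, nrm, ⟨_, _, hhom, _⟩, -, -, -, -, hexp⟩, -⟩ := hν
  have := hhom (-1) x
  rw [neg_one_smul, abs_neg, abs_one, one_mul] at this
  rw [hexp, hexp, this]

theorem Admissible.add_le_mul {ν : Euc d → ℝ} (hν : Admissible ν) (x y : Euc d) :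
    ν (x + y) ≤ ν x * ν y := by
  obtain ⟨⟨ρ, nrm, ⟨hn0, _, _, htri⟩, -, hρ, h00, h0, hexp⟩, -⟩ := hν
  rw [hexp, hexp, hexp, ← Real.exp_add, Real.exp_le_exp]
  have h1 := hρ.monotoneOn_of_nonneg h0 (hn0 _) (Set.mem_Ici.2 (add_nonneg (hn0 x) (hn0 y)))
    (htri x y)
  rcases (hn0 y).eq_or_lt with h | h
  · rw [← h, add_zero] at h1
    rw [← h, h00, add_zero]
    exact h1
  · have h2 := hρ.secant_shift_le (a := 0) (h := nrm y) (c := nrm x) (k := nrm y) le_rfl h.le h.le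
      (hn0 x) (by linarith [hn0 x])
    rw [zero_add, h00, sub_zero] at h2
    linarith [le_of_mul_le_mul_right h2 h]

/-- An admissible weight with a polynomial lower bound admits equivalent weights `V` which are
almost additive up to a submultiplicative factor `U` of smaller order. -/
theorem Admissible.exists_equivalent_weight {ν : Euc d → ℝ} (hν : Admissible ν) {δ C₀ : ℝ}
    (hδ0 : 0 < δ) (hC₀ : 0 < C₀) (hgrowth : ∀ x : Euc d, C₀ * (1 + ‖x‖) ^ δ ≤ ν x)
    {z : Euc d} (hz : z ≠ 0) (α : Fin d → ℕ) {η : ℝ} (hη : 0 < η) :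
    ∃ (V U : Euc d → ℝ) (C : ℝ), 0 ≤ C ∧ (∀ x, 0 ≤ V x) ∧ (∀ x, 0 ≤ U x) ∧
      (∀ x, V x ≤ polyWeight α 1 x * ν x) ∧ (∀ x, polyWeight α 1 x * ν x ≤ C * V x) ∧
      (∀ x y, V (x + y) ≤ V x * U y + U x * V y) ∧ (∀ x y, U (x + y) ≤ U x * U y) ∧
      ∀ x, U x ≤ 4 * 1 + η * (polyWeight α 1 x * ν x) := by
  obtain ⟨⟨ρ, nrm, ⟨hn0, hn00, hhom, htri⟩, -, hρ, h00, h0, hexp⟩, hGRS⟩ := hν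
  have hmono := hρ.monotoneOn_of_nonneg h0
  have hnz : 0 < nrm z := lt_of_le_of_ne (hn0 z) fun h => hz ((hn00 z).1 h.symm)
  have hsub : ∀ ε > 0, ∃ N > 0, ρ N ≤ ε * N := by
    intro ε hε
    have h1 : (1 : ℝ) < Real.exp (ε * nrm z) := Real.one_lt_exp_iff.2 (by positivity)
    obtain ⟨n, hn, hn1⟩ := ((hGRS z).eventually_lt_const h1 |>.and (eventually_ge_atTop 1)).exists
    have hn0' : (0 : ℝ) < n := by exact_mod_cast hn1
    rw [hexp, ← Real.exp_mul, Real.exp_lt_exp, hhom, abs_of_pos hn0', mul_one_div,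
      div_lt_iff₀ hn0'] at hn
    exact ⟨n * nrm z, by positivity, by linarith⟩
  have hunb : ∀ K, ∃ t, 0 ≤ t ∧ K ≤ ρ t := by
    intro K
    have hlim : Tendsto (fun n : ℕ => C₀ * (1 + (n : ℝ) * ‖z‖) ^ δ) atTop atTop :=
      ((tendsto_rpow_atTop hδ0).comp (tendsto_atTop_add_const_left _ _
        (tendsto_natCast_atTop_atTop.atTop_mul_const (norm_pos_iff.2 hz)))).const_mul_atTop hC₀
    obtain ⟨n, hn⟩ := (hlim.eventually_ge_atTop (Real.exp K)).exists
    refine ⟨nrm ((n : ℝ) • z), hn0 _, ?_⟩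
    rw [← Real.exp_le_exp, ← hexp]
    refine hn.trans (le_trans (le_of_eq ?_) (hgrowth _))
    rw [norm_smul, Real.norm_natCast]
  obtain ⟨L, hL, hfar⟩ := hρ.exists_forall_dyadicIncr_le h00 h0 hsub hunb (-Real.log η)
  obtain ⟨M, hMν⟩ : ∃ M, ∀ x : Euc d, nrm x ≤ L → ‖x‖ ≤ M := by
    refine ⟨(Real.exp (ρ L) / C₀) ^ δ⁻¹, fun x hx => ?_⟩
    have h1 : (1 + ‖x‖) ^ δ ≤ Real.exp (ρ L) / C₀ := by
      rw [le_div_iff₀' hC₀]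
      refine (hgrowth x).trans ?_
      rw [hexp, Real.exp_le_exp]
      exact hmono (hn0 x) hL hx
    have h2 := Real.rpow_le_rpow (by positivity) h1 (inv_nonneg.2 hδ0.le)
    rw [Real.rpow_rpow_inv (by positivity) hδ0.ne'] at h2
    linarith
  obtain ⟨ε, hε, hε1, hεM⟩ := exists_polyWeight_le_two α M
  obtain ⟨N, hN, hshift⟩ := hρ.exists_shift_le h00 hsub (ε := Real.log 2 / (L + 1))
    (div_pos (Real.log_pos one_lt_two) (by linarith))
  have hpoly : ∀ x, 0 ≤ polyWeight α ε x := fun x => zero_le_one.trans (one_le_polyWeight α hε.le x)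
  have hpoly1 : ∀ x, 0 ≤ polyWeight α 1 x := fun x =>
    zero_le_one.trans (one_le_polyWeight α zero_le_one x)
  have hpm : ∀ x, polyWeight α ε x ≤ polyWeight α 1 x := polyWeight_mono α hε.le hε1
  have hV : ∀ x y, nrm y ≤ nrm x → polyWeight α ε (x + y) * Real.exp (ρ (nrm (x + y) + N) - ρ N) ≤
      polyWeight α ε x * Real.exp (ρ (nrm x + N) - ρ N) *
        (polyWeight α ε y * Real.exp (dyadicIncr ρ N (nrm y))) := by
    intro x y hyx
    rw [mul_mul_mul_comm, ← Real.exp_add]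
    refine mul_le_mul (polyWeight_add_le α hε.le x y) (Real.exp_le_exp.2 ?_)
      (Real.exp_nonneg _) (mul_nonneg (hpoly x) (hpoly y))
    have h1 := hρ.add_le_add_dyadicIncr h0 hN.le (hn0 y) hyx
    have h2 := hmono (Set.mem_Ici.2 (add_nonneg (hn0 (x + y)) hN.le))
      (Set.mem_Ici.2 (by linarith [hn0 x, hn0 y])) (add_le_add_left (htri x y) N)
    linarith
  refine ⟨fun x => polyWeight α ε x * Real.exp (ρ (nrm x + N) - ρ N),
    fun x => polyWeight α ε x * Real.exp (dyadicIncr ρ N (nrm x)),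
    (∏ j, ε⁻¹ ^ α j) * Real.exp (ρ N), by positivity,
    fun x => mul_nonneg (hpoly x) (Real.exp_nonneg _),
    fun x => mul_nonneg (hpoly x) (Real.exp_nonneg _), fun x => ?_, fun x => ?_, fun x y => ?_,
    fun x y => ?_, fun x => ?_⟩
  · rw [hexp]
    refine mul_le_mul (hpm x) (Real.exp_le_exp.2 ?_) (Real.exp_nonneg _) (hpoly1 x)
    have := hρ.secant_shift_le (a := 0) (h := nrm x) (c := N) (k := nrm x) le_rfl (hn0 x) (hn0 x)
      hN.le (by linarith)
    rcases (hn0 x).eq_or_lt with h | h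
    · rw [← h, zero_add, sub_self, h00]
    · rw [zero_add, h00, sub_zero, add_comm N] at this
      exact le_of_mul_le_mul_right this h
  · rw [hexp, mul_mul_mul_comm, ← Real.exp_add]
    refine mul_le_mul (polyWeight_one_le α hε hε1 x) (Real.exp_le_exp.2 ?_) (Real.exp_nonneg _)
      (mul_nonneg (by positivity) (hpoly x))
    have := hmono (hn0 x) (Set.mem_Ici.2 (add_nonneg (hn0 x) hN.le)) (le_add_of_nonneg_right hN.le)
    linarith
  · have hnn : ∀ x y : Euc d, 0 ≤ polyWeight α ε x * Real.exp (ρ (nrm x + N) - ρ N) *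
        (polyWeight α ε y * Real.exp (dyadicIncr ρ N (nrm y))) := fun x y =>
      mul_nonneg (mul_nonneg (hpoly x) (Real.exp_nonneg _))
        (mul_nonneg (hpoly y) (Real.exp_nonneg _))
    rcases le_total (nrm y) (nrm x) with h | h
    · refine (hV x y h).trans (le_add_of_nonneg_right ?_)
      rw [mul_comm]
      exact hnn y x
    · rw [add_comm x y]
      refine (hV y x h).trans ?_
      rw [mul_comm (polyWeight α ε x * Real.exp (dyadicIncr ρ N (nrm x)))]
      exact le_add_of_nonneg_left (hnn x y)
  · simp only
    rw [mul_mul_mul_comm, ← Real.exp_add]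
    refine mul_le_mul (polyWeight_add_le α hε.le x y) (Real.exp_le_exp.2 ?_)
      (Real.exp_nonneg _) (mul_nonneg (hpoly x) (hpoly y))
    exact (hρ.dyadicIncr_mono h0 hN.le (hn0 _) (htri x y)).trans
      (hρ.dyadicIncr_subadditive h0 hN.le (hn0 x) (hn0 y))
  · rcases le_total L (nrm x) with h | h
    · have h1 := hfar (nrm x) h N hN.le
      have h2 : Real.exp (dyadicIncr ρ N (nrm x)) ≤ η * ν x := by
        rw [hexp, ← Real.exp_log hη, ← Real.exp_add, Real.exp_le_exp]
        linarith
      calc polyWeight α ε x * Real.exp (dyadicIncr ρ N (nrm x))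
          ≤ polyWeight α 1 x * (η * ν x) :=
            mul_le_mul (hpm x) h2 (Real.exp_nonneg _) (hpoly1 x)
        _ ≤ _ := by linarith
    · have h1 : dyadicIncr ρ N (nrm x) ≤ Real.log 2 := by
        refine (hρ.dyadicIncr_le_shift h0 hN.le (hn0 x)).trans ((hshift _ (hn0 x)).trans ?_)
        rw [div_mul_eq_mul_div, div_le_iff₀ (by linarith)]
        exact mul_le_mul_of_nonneg_left (by linarith) (Real.log_nonneg one_le_two)
      have h2 : Real.exp (dyadicIncr ρ N (nrm x)) ≤ 2 := by
        rw [← Real.exp_log two_pos]; exact Real.exp_le_exp.2 h1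
      have h3 : 0 ≤ η * (polyWeight α 1 x * ν x) := by
        rw [hexp]; exact mul_nonneg hη.le (mul_nonneg (hpoly1 x) (Real.exp_nonneg _))
      have h4 := mul_le_mul (hεM x (hMν x h)) h2 (Real.exp_nonneg _) zero_le_two
      linarith

end Weights
/-! ### Powers of contractions -/

theorem tendsto_zero_of_quadratic_recursion {t : ℕ → ℝ} {C r q y : ℝ} (ht : ∀ k, 0 ≤ t k)
    (hC : 0 ≤ C) (hr0 : 0 ≤ r) (hr1 : r < 1) (hq0 : 0 ≤ q) (hq1 : q < 1) (hy : 0 ≤ y)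
    (hty : ∀ k, t k ≤ y ^ 2 ^ k)
    (hrec : ∀ k, t (k + 1) ≤ 2 * t k * (C * r ^ 2 ^ k + q ^ 2 ^ k * t k)) :
    Tendsto t atTop (nhds 0) := by
  set s := max (max r q) (1 / 4) with hs
  have hs0 : 0 < s := lt_max_of_lt_right (by norm_num)
  have hs1 : s < 1 := max_lt (max_lt hr1 hq1) (by norm_num)
  have hrs : r ≤ s := (le_max_left _ _).trans (le_max_left _ _)
  have hqs : q ≤ s := (le_max_right _ _).trans (le_max_left _ _)
  set κ := √s with hκ
  have hκ0 : 0 < κ := Real.sqrt_pos.2 hs0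
  have hκ1 : κ < 1 := by rw [hκ, Real.sqrt_lt' one_pos]; simpa using hs1
  have hκs : κ ^ 2 = s := Real.sq_sqrt hs0.le
  have step : ∀ z, 1 ≤ z → (∃ M, 0 ≤ M ∧ ∀ k, t k ≤ M * z ^ 2 ^ k) →
      ∃ M, 0 ≤ M ∧ ∀ k, t k ≤ M * (κ * z) ^ 2 ^ k := by
    rintro z hz ⟨M, hM, hMt⟩
    have hz0 : 0 < z := by linarith
    have h0 := ht 0
    refine ⟨2 * C * M + 2 * M ^ 2 + t 0 / (κ * z), by positivity, fun k => ?_⟩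
    cases k with
    | zero =>
      rw [pow_zero, pow_one, add_mul, div_mul_cancel₀ _ (by positivity)]
      exact le_add_of_nonneg_left (by positivity)
    | succ k =>
      have hY : 1 ≤ z ^ 2 ^ k := one_le_pow₀ hz
      have hK : 0 < s ^ 2 ^ k := by positivity
      have hr := pow_le_pow_left₀ hr0 hrs (2 ^ k)
      have hq := pow_le_pow_left₀ hq0 hqs (2 ^ k)
      have hpow : (κ * z) ^ 2 ^ (k + 1) = s ^ 2 ^ k * (z ^ 2 ^ k) ^ 2 := by
        rw [mul_pow, pow_succ, mul_comm (2 ^ k), pow_mul, hκs, mul_comm 2, pow_mul z]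
      have hk := hMt k
      have htk := ht k
      calc t (k + 1) ≤ 2 * t k * (C * r ^ 2 ^ k + q ^ 2 ^ k * t k) := hrec k
        _ ≤ 2 * (M * z ^ 2 ^ k) * (C * s ^ 2 ^ k + s ^ 2 ^ k * (M * z ^ 2 ^ k)) := by gcongr
        _ = (2 * C * M * z ^ 2 ^ k + 2 * M ^ 2 * (z ^ 2 ^ k) ^ 2) * s ^ 2 ^ k := by ring
        _ ≤ (2 * C * M * (z ^ 2 ^ k) ^ 2 + 2 * M ^ 2 * (z ^ 2 ^ k) ^ 2) * s ^ 2 ^ k := by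
          gcongr
          exact le_self_pow₀ hY two_ne_zero
        _ = (2 * C * M + 2 * M ^ 2) * (κ * z) ^ 2 ^ (k + 1) := by rw [hpow]; ring
        _ ≤ _ := mul_le_mul_of_nonneg_right (le_add_of_nonneg_right (by positivity))
          (by positivity)
  obtain ⟨z, hz0, hz1, M, -, hMt⟩ :
      ∃ z, 0 ≤ z ∧ z < 1 ∧ ∃ M, 0 ≤ M ∧ ∀ k, t k ≤ M * z ^ 2 ^ k := by
    by_contra hcon
    have hall : ∀ n : ℕ, ∃ M, 0 ≤ M ∧ ∀ k, t k ≤ M * (κ ^ n * y) ^ 2 ^ k := by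
      intro n
      induction n with
      | zero => exact ⟨1, zero_le_one, by simpa using hty⟩
      | succ n ih =>
        rw [pow_succ', mul_assoc]
        refine step _ (not_lt.1 fun h => hcon ⟨_, by positivity, h, ih⟩) ih
    have hlim : Tendsto (fun n : ℕ => κ ^ n * y) atTop (nhds (0 * y)) :=
      (tendsto_pow_atTop_nhds_zero_of_lt_one hκ0.le hκ1).mul_const y
    obtain ⟨n, hn⟩ := (hlim.eventually_lt_const (by simp : 0 * y < 1)).exists
    exact hcon ⟨_, by positivity, hn, hall n⟩
  have hlim : Tendsto (fun k : ℕ => M * z ^ 2 ^ k) atTop (nhds (M * 0)) :=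
    ((tendsto_pow_atTop_nhds_zero_of_lt_one hz0 hz1).comp
      (tendsto_pow_atTop_atTop_of_one_lt one_lt_two)).const_mul M
  rw [mul_zero] at hlim
  exact squeeze_zero ht hMt hlim

section Inverse

variable {d : ℕ} {X : Set (Euc d)} {H : Type*} [NormedAddCommGroup H] [InnerProductSpace ℂ H]

/-- The unweighted Schur norms of the powers of a contraction with polynomial off-diagonal decay
become arbitrarily small. -/
theorem exists_wNorm_one_pow_le (hX : RelSep X) {δ : ℝ} (hδ0 : 0 < δ) (hδ1 : δ ≤ 1)
    {R : lp (fun _ : X => H) 2 →L[ℂ] lp (fun _ : X => H) 2} (hR : ‖R‖ < 1)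
    (hτ : wNorm (fun x => (1 + ‖x‖) ^ δ) R < ∞) {ε : ℝ} (hε : 0 < ε) :
    ∃ n, 0 < n ∧ wNorm (fun _ => 1) (R ^ n) ≤ ENNReal.ofReal ε := by
  obtain ⟨N, hN⟩ := hX
  set τ : Euc d → ℝ := fun x => (1 + ‖x‖) ^ δ with hτdef
  have hτ0 : ∀ x, 0 ≤ τ x := fun x => by positivity
  have hτ1 : ∀ x, 1 ≤ τ x := fun x => Real.one_le_rpow (by linarith [norm_nonneg x]) hδ0.le
  have hτmul : ∀ x y, τ (x + y) ≤ τ x * τ y := one_add_norm_rpow_submultiplicative hδ0.le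
  have hfin : ∀ n, wNorm τ (R ^ n) < ∞ := wNorm_pow_lt_top R hτ0 hτmul hτ
  have hle1 : ∀ A : lp (fun _ : X => H) 2 →L[ℂ] lp (fun _ : X => H) 2,
      wNorm (fun _ => 1) A ≤ wNorm τ A := fun A => wNorm_mono A hτ1
  have hsq : ∀ A : lp (fun _ : X => H) 2 →L[ℂ] lp (fun _ : X => H) 2,
      wNorm τ (A * A) ≤ 2 * wNorm τ A * wNorm (fun _ => 1) A := by
    intro A
    refine (wNorm_mul_le_add (w₁ := τ) (u := fun _ => 1) (w₂ := fun _ => 1) (v := τ) A A hτ0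
      (fun _ => zero_le_one) fun x y => ?_).trans_eq (by ring)
    rw [mul_one, one_mul]
    exact one_add_norm_rpow_subadditive hδ0.le hδ1 x y
  obtain ⟨b, hb1, hbR⟩ : ∃ b : ℝ, 1 < b ∧ b ^ d * ‖R‖ < 1 := by
    have hc : Continuous fun b : ℝ => b ^ d * ‖R‖ := by fun_prop
    have hev : ∀ᶠ b in nhdsWithin (1 : ℝ) (Set.Ioi 1), b ^ d * ‖R‖ < 1 :=
      (hc.continuousAt.eventually_lt_const (by simpa using hR)).filter_mono nhdsWithin_le_nhds
    obtain ⟨b, hb, hb1⟩ := (hev.and self_mem_nhdsWithin).exists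
    exact ⟨b, hb1, hb⟩
  have hb0 : 0 < b := by linarith
  set t : ℕ → ℝ := fun k => (wNorm τ (R ^ 2 ^ k)).toReal with ht
  have hofReal : ∀ k, wNorm τ (R ^ 2 ^ k) = ENNReal.ofReal (t k) := fun k =>
    (ENNReal.ofReal_toReal (hfin _).ne).symm
  have ht0 : ∀ k, 0 ≤ t k := fun k => ENNReal.toReal_nonneg
  have hlim : Tendsto t atTop (nhds 0) := by
    refine tendsto_zero_of_quadratic_recursion (C := 5 ^ d * N) (r := b ^ d * ‖R‖)
      (q := b ^ (-δ)) (y := (wNorm τ R).toReal) ht0 (by positivity) (by positivity) hbR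
      (by positivity) (Real.rpow_lt_one_of_one_lt_of_neg hb1 (by linarith))
      ENNReal.toReal_nonneg (fun k => ?_) fun k => ?_
    · rw [← ENNReal.toReal_pow]
      refine ENNReal.toReal_mono (ENNReal.pow_lt_top hτ).ne ?_
      obtain ⟨n, hn⟩ := Nat.exists_eq_succ_of_ne_zero (pow_pos two_pos k).ne'
      rw [hn]
      exact wNorm_pow_succ_le R hτ0 hτmul n
    · have hL : 1 ≤ b ^ 2 ^ k := one_le_pow₀ hb1.le
      have h1 : wNorm (fun _ => 1) (R ^ 2 ^ k) ≤
          ENNReal.ofReal (5 ^ d * N * (b ^ d * ‖R‖) ^ 2 ^ k + (b ^ (-δ)) ^ 2 ^ k * t k) := by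
        refine (wNorm_one_le_near_add_far (R ^ 2 ^ k) hN hδ0.le hL).trans ?_
        have hqk : 0 ≤ (b ^ 2 ^ k) ^ (-δ) := by positivity
        rw [hofReal, ← ENNReal.ofReal_mul hqk]
        refine (ENNReal.ofReal_add (mul_nonneg (by positivity) (norm_nonneg (R ^ 2 ^ k)))
          (mul_nonneg hqk (ht0 k))).symm.trans_le
          (ENNReal.ofReal_le_ofReal (add_le_add ?_ (le_of_eq ?_)))
        · calc (5 * b ^ 2 ^ k) ^ d * N * ‖R ^ 2 ^ k‖
              ≤ (5 * b ^ 2 ^ k) ^ d * N * ‖R‖ ^ 2 ^ k :=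
                mul_le_mul_of_nonneg_left (norm_pow_le' R (by positivity)) (by positivity)
            _ = _ := by ring
        · rw [← Real.rpow_natCast, ← Real.rpow_natCast, ← Real.rpow_mul hb0.le,
            ← Real.rpow_mul hb0.le, mul_comm (-δ)]
      have h2 : wNorm τ (R ^ 2 ^ (k + 1)) ≤ ENNReal.ofReal
          (2 * t k * (5 ^ d * N * (b ^ d * ‖R‖) ^ 2 ^ k + (b ^ (-δ)) ^ 2 ^ k * t k)) := by
        have hsplit : R ^ 2 ^ (k + 1) = R ^ 2 ^ k * R ^ 2 ^ k := by
          rw [← pow_add, pow_succ, mul_two]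
        have h2t : 0 ≤ 2 * t k := mul_nonneg zero_le_two (ht0 k)
        rw [hsplit, ENNReal.ofReal_mul h2t, ENNReal.ofReal_mul zero_le_two, ← hofReal,
          ENNReal.ofReal_ofNat]
        exact (hsq _).trans (by gcongr)
      rw [hofReal] at h2
      have hnn : 0 ≤ 2 * t k *
          (5 ^ d * N * (b ^ d * ‖R‖) ^ 2 ^ k + (b ^ (-δ)) ^ 2 ^ k * t k) := by
        have := ht0 k
        positivity
      exact (ENNReal.ofReal_le_ofReal_iff hnn).1 h2
  obtain ⟨k, hk⟩ := (hlim.eventually_lt_const hε).exists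
  refine ⟨2 ^ k, by positivity, (hle1 _).trans ?_⟩
  rw [hofReal]
  exact ENNReal.ofReal_le_ofReal hk.le

/-- The Neumann series preserves finiteness of the weighted Schur norm. -/
theorem wNorm_tsum_pow_lt_top {V U W : Euc d → ℝ} {C : ℝ} (hC : 0 ≤ C) (hV : ∀ x, 0 ≤ V x)
    (hU : ∀ x, 0 ≤ U x) (hVW : ∀ x, V x ≤ W x) (hWV : ∀ x, W x ≤ C * V x)
    (hVU : ∀ x y, V (x + y) ≤ V x * U y + U x * V y) (hUU : ∀ x y, U (x + y) ≤ U x * U y)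
    {B : lp (fun _ : X => H) 2 →L[ℂ] lp (fun _ : X => H) 2}
    (hB : Summable fun n : ℕ => B ^ n) (hBW : wNorm W B < ∞) (hBU : wNorm U B ≤ 4⁻¹) :
    wNorm W (∑' n : ℕ, B ^ n) < ∞ := by
  have hBV : wNorm V B < ∞ := (wNorm_mono B hVW).trans_lt hBW
  have hpow : ∀ m : ℕ, wNorm V (B ^ (m + 1)) ≤ 2⁻¹ ^ m * wNorm V B := by
    have hU' : ∀ m : ℕ, wNorm U (B ^ (m + 1)) ≤ 4⁻¹ * 2⁻¹ ^ m := by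
      intro m
      refine (wNorm_pow_succ_le B hU hUU m).trans ?_
      rw [pow_succ']
      gcongr
      exact hBU.trans (ENNReal.inv_le_inv.2 (by norm_num))
    intro m
    induction m with
    | zero => simp
    | succ m ih =>
      rw [pow_succ B]
      refine (wNorm_mul_le_add _ _ hV hU hVU).trans ?_
      calc wNorm V (B ^ (m + 1)) * wNorm U B + wNorm U (B ^ (m + 1)) * wNorm V B
          ≤ 2⁻¹ ^ m * wNorm V B * 4⁻¹ + 4⁻¹ * 2⁻¹ ^ m * wNorm V B := by
            gcongr
            exact hU' m
        _ = 2⁻¹ ^ m * (2 * 4⁻¹) * wNorm V B := by ring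
        _ = 2⁻¹ ^ (m + 1) * wNorm V B := by
            rw [pow_succ]
            congr 2
            rw [show (4 : ℝ≥0∞) = 2 * 2 by norm_num, ENNReal.mul_inv (by simp) (by simp),
              ← mul_assoc, ENNReal.mul_inv_cancel (by simp) (by simp), one_mul]
  have hVfin : wNorm V (∑' n : ℕ, B ^ n) < ∞ := by
    refine (wNorm_tsum_le hB).trans_lt ?_
    rw [tsum_eq_zero_add' ENNReal.summable]
    refine ENNReal.add_lt_top.2 ⟨?_, (ENNReal.tsum_le_tsum hpow).trans_lt ?_⟩
    · rw [pow_zero]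
      exact wNorm_one_le.trans_lt (ENNReal.mul_lt_top enorm_lt_top ENNReal.ofReal_lt_top)
    · rw [ENNReal.tsum_mul_right, ENNReal.tsum_geometric]
      refine ENNReal.mul_lt_top ?_ hBV
      rw [ENNReal.one_sub_inv_two, inv_inv]
      exact ENNReal.ofNat_lt_top
  exact (wNorm_le_mul _ hC hWV).trans_lt (ENNReal.mul_lt_top ENNReal.ofReal_lt_top hVfin)

end Inverse
/-! ### Inverse-closedness -/

theorem norm_one_sub_smul_adjoint_mul_self_lt_one {E : Type*} [NormedAddCommGroup E]
    [InnerProductSpace ℂ E] [CompleteSpace E] {S T : E →L[ℂ] E} (hST : S * T = 1) {c : ℝ}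
    (hc : 0 < c) (hcT : c * ‖T‖ ^ 2 ≤ 1) :
    ‖1 - (c : ℂ) • (ContinuousLinearMap.adjoint T * T)‖ < 1 := by
  set θ := max (1 - c / (1 + ‖S‖) ^ 2) 0 with hθ
  have hS1 : 0 < 1 + ‖S‖ := by positivity
  have hθ1 : θ < 1 := max_lt (sub_lt_self _ (by positivity)) one_pos
  have hθ0 : 0 ≤ θ := le_max_right _ _
  refine (ContinuousLinearMap.opNorm_le_bound _ (Real.sqrt_nonneg θ) fun f => ?_).trans_lt
    (by rw [Real.sqrt_lt' one_pos]; simpa using hθ1)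
  set g := ContinuousLinearMap.adjoint T (T f) with hg
  have hRf : (1 - (c : ℂ) • (ContinuousLinearMap.adjoint T * T)) f = f - (c : ℂ) • g := rfl
  have hinner : RCLike.re (inner ℂ f ((c : ℂ) • g)) = c * ‖T f‖ ^ 2 := by
    rw [inner_smul_right, hg, ContinuousLinearMap.adjoint_inner_right, inner_self_eq_norm_sq_to_K]
    have h : (c : ℂ) * (‖T f‖ : ℂ) ^ 2 = ((c * ‖T f‖ ^ 2 : ℝ) : ℂ) := by push_cast; rfl
    exact (congrArg Complex.re h).trans (Complex.ofReal_re _)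
  have hgn : ‖g‖ ^ 2 ≤ ‖T‖ ^ 2 * ‖T f‖ ^ 2 := by
    rw [← mul_pow]
    refine pow_le_pow_left₀ (norm_nonneg _) ?_ 2
    have := (ContinuousLinearMap.adjoint T).le_opNorm (T f)
    rwa [LinearIsometryEquiv.norm_map] at this
  have hf : ‖f‖ ≤ (1 + ‖S‖) * ‖T f‖ := by
    have h1 : S (T f) = f := by rw [← mul_apply_eq_comp, hST]; rfl
    calc ‖f‖ = ‖S (T f)‖ := by rw [h1]
      _ ≤ ‖S‖ * ‖T f‖ := S.le_opNorm _
      _ ≤ _ := by gcongr; linarith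
  have hf2 : c / (1 + ‖S‖) ^ 2 * ‖f‖ ^ 2 ≤ c * ‖T f‖ ^ 2 := by
    rw [div_mul_eq_mul_div, div_le_iff₀ (by positivity), mul_assoc, ← mul_pow, mul_comm ‖T f‖]
    gcongr
  have hsq : ‖f - (c : ℂ) • g‖ ^ 2 ≤ θ * ‖f‖ ^ 2 := by
    rw [norm_sub_sq (𝕜 := ℂ), hinner, norm_smul, Complex.norm_real, Real.norm_of_nonneg hc.le,
      mul_pow]
    have h1 : c ^ 2 * ‖g‖ ^ 2 ≤ c * ‖T f‖ ^ 2 := by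
      calc c ^ 2 * ‖g‖ ^ 2 ≤ c ^ 2 * (‖T‖ ^ 2 * ‖T f‖ ^ 2) := by gcongr
        _ = c * ‖T‖ ^ 2 * (c * ‖T f‖ ^ 2) := by ring
        _ ≤ 1 * (c * ‖T f‖ ^ 2) := by gcongr
        _ = _ := one_mul _
    have h2 : (1 - c / (1 + ‖S‖) ^ 2) * ‖f‖ ^ 2 ≤ θ * ‖f‖ ^ 2 := by
      gcongr
      exact le_max_left _ _
    linarith
  rw [hRf, ← Real.sqrt_sq (norm_nonneg f), ← Real.sqrt_mul hθ0]
  exact Real.le_sqrt_of_sq_le hsq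

section InverseClosed

variable {d : ℕ} {X : Set (Euc d)} {H : Type*} [NormedAddCommGroup H] [InnerProductSpace ℂ H]

theorem summable_and_bddAbove_iff {ι : Type*} {f : ι → ι → ℝ} (hf : ∀ k l, 0 ≤ f k l) :
    ((∀ k, Summable (f k)) ∧ BddAbove (Set.range fun k => ∑' l, f k l)) ↔
      ⨆ k, ∑' l, ENNReal.ofReal (f k l) < ∞ := by
  constructor
  · rintro ⟨hs, M, hM⟩
    refine (iSup_le fun k => ?_ : _ ≤ ENNReal.ofReal M).trans_lt ENNReal.ofReal_lt_top
    rw [← ENNReal.ofReal_tsum_of_nonneg (hf k) (hs k)]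
    exact ENNReal.ofReal_le_ofReal (hM ⟨k, rfl⟩)
  · intro h
    have hle := le_iSup fun k => ∑' l, ENNReal.ofReal (f k l)
    have hs : ∀ k, Summable (f k) := fun k => by
      have := ENNReal.summable_toReal ((hle k).trans_lt h).ne
      simpa only [ENNReal.toReal_ofReal (hf k _)] using this
    refine ⟨hs, (⨆ k, ∑' l, ENNReal.ofReal (f k l)).toReal, ?_⟩
    rintro _ ⟨k, rfl⟩
    refine (ENNReal.ofReal_le_iff_le_toReal h.ne).1 ?_
    rw [ENNReal.ofReal_tsum_of_nonneg (hf k) (hs k)]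
    exact hle k

theorem memAnisoSchur_entry_iff {ν : Euc d → ℝ} (hν : ∀ x, 0 ≤ ν x) (α : Fin d → ℕ)
    (T : lp (fun _ : X => H) 2 →L[ℂ] lp (fun _ : X => H) 2) :
    MemAnisoSchur ν α (entry T) ↔ wNorm (fun x => polyWeight α 1 x * ν x) T < ∞ := by
  set f : X → X → ℝ := fun k l => (∏ j : Fin d, (1 + |(k : Euc d) j - (l : Euc d) j|) ^ (α j)) *
    ‖entry T k l‖ * ν ((k : Euc d) - (l : Euc d)) with hf
  have hf0 : ∀ k l, 0 ≤ f k l := fun k l =>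
    mul_nonneg (mul_nonneg (by positivity) (norm_nonneg _)) (hν _)
  have hfe : ∀ k l, ‖entry T k l‖ₑ * ENNReal.ofReal (polyWeight α 1 ((k : Euc d) - l) *
      ν ((k : Euc d) - l)) = ENNReal.ofReal (f k l) := fun k l => by
    rw [← ofReal_norm (entry T k l), ← ENNReal.ofReal_mul (norm_nonneg (entry T k l))]
    simp only [hf, polyWeight, one_mul, PiLp.sub_apply]
    congr 1
    ring
  have h1 := summable_and_bddAbove_iff hf0
  have h2 := summable_and_bddAbove_iff fun k l => hf0 l k
  rw [wNorm, schurNorm]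
  simp only [hfe]
  rw [max_lt_iff, ← h1, ← h2, and_assoc]
  rfl

variable [CompleteSpace H]

theorem wNorm_inverse_lt_top (hX : RelSep X) {ν : Euc d → ℝ} (hν : Admissible ν)
    {δ C₀ : ℝ} (hδ0 : 0 < δ) (hδ1 : δ ≤ 1) (hC₀ : 0 < C₀)
    (hgrowth : ∀ x : Euc d, C₀ * (1 + ‖x‖) ^ δ ≤ ν x) {z : Euc d} (hz : z ≠ 0) (α : Fin d → ℕ)
    {S T : lp (fun _ : X => H) 2 →L[ℂ] lp (fun _ : X => H) 2} (hST : S * T = 1) (hTS : T * S = 1)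
    (hT : wNorm (fun x => polyWeight α 1 x * ν x) T < ∞) :
    wNorm (fun x => polyWeight α 1 x * ν x) S < ∞ := by
  set W : Euc d → ℝ := fun x => polyWeight α 1 x * ν x with hW
  have hp1 : ∀ x, 1 ≤ polyWeight α 1 x := one_le_polyWeight α zero_le_one
  have hν0 : ∀ x, 0 ≤ ν x := fun x => le_trans (by positivity) (hgrowth x)
  have hW0 : ∀ x, 0 ≤ W x := fun x => mul_nonneg (zero_le_one.trans (hp1 x)) (hν0 x)
  have hWmul : ∀ x y, W (x + y) ≤ W x * W y := fun x y => by
    simp only [hW]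
    rw [mul_mul_mul_comm]
    exact mul_le_mul (polyWeight_add_le α zero_le_one x y) (hν.add_le_mul x y) (hν0 _)
      (mul_nonneg (zero_le_one.trans (hp1 x)) (zero_le_one.trans (hp1 y)))
  have hWneg : ∀ x, W (-x) = W x := fun x => by
    simp only [hW]
    rw [polyWeight_neg, hν.neg]
  have hτW : ∀ x, (1 + ‖x‖) ^ δ ≤ C₀⁻¹ * W x := fun x => by
    rw [← div_eq_inv_mul, le_div_iff₀' hC₀]
    exact (hgrowth x).trans (le_mul_of_one_le_left (hν0 x) (hp1 x))
  set T' := ContinuousLinearMap.adjoint T with hT'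
  have hT'W : wNorm W T' < ∞ := by rwa [hT', wNorm_adjoint T hWneg]
  set c : ℝ := 1 / (1 + ‖T‖ ^ 2) with hc
  have hTn : 0 ≤ ‖T‖ := norm_nonneg T
  have hc0 : 0 < c := by positivity
  have hcT : c * ‖T‖ ^ 2 ≤ 1 := by
    rw [hc, div_mul_eq_mul_div, one_mul, div_le_one (by positivity)]
    linarith
  set R := 1 - (c : ℂ) • (T' * T) with hR
  have hR1 : ‖R‖ < 1 := norm_one_sub_smul_adjoint_mul_self_lt_one hST hc0 hcT
  have hsmul : ∀ (a : ℂ) (A : lp (fun _ : X => H) 2 →L[ℂ] lp (fun _ : X => H) 2),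
      wNorm W A < ∞ → wNorm W (a • A) < ∞ := fun a A hA =>
    (wNorm_smul_le A a).trans_lt (ENNReal.mul_lt_top enorm_lt_top hA)
  have hmul : ∀ A B : lp (fun _ : X => H) 2 →L[ℂ] lp (fun _ : X => H) 2,
      wNorm W A < ∞ → wNorm W B < ∞ → wNorm W (A * B) < ∞ := fun A B hA hB =>
    (wNorm_mul_le A B hW0 hWmul).trans_lt (ENNReal.mul_lt_top hA hB)
  have hone : wNorm W (1 : lp (fun _ : X => H) 2 →L[ℂ] lp (fun _ : X => H) 2) < ∞ :=
    wNorm_one_le.trans_lt (ENNReal.mul_lt_top enorm_lt_top ENNReal.ofReal_lt_top)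
  have hRW : wNorm W R < ∞ := by
    rw [hR, sub_eq_add_neg, ← neg_smul]
    exact (wNorm_add_le _ _).trans_lt (ENNReal.add_lt_top.2 ⟨hone, hsmul _ _ (hmul _ _ hT'W hT)⟩)
  have hRτ : wNorm (fun x => (1 + ‖x‖) ^ δ) R < ∞ :=
    (wNorm_le_mul R (by positivity) hτW).trans_lt (ENNReal.mul_lt_top ENNReal.ofReal_lt_top hRW)
  obtain ⟨n, hn, hn1⟩ := exists_wNorm_one_pow_le hX hδ0 hδ1 hR1 hRτ
    (by norm_num : (0 : ℝ) < 1 / 32)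
  set B := R ^ n with hB
  have hBW : wNorm W B < ∞ := wNorm_pow_lt_top R hW0 hWmul hRW n
  have hBn : ‖B‖ < 1 :=
    (norm_pow_le' R hn).trans_lt (pow_lt_one₀ (norm_nonneg _) hR1 hn.ne')
  set η : ℝ := 1 / (8 * (1 + (wNorm W B).toReal)) with hη
  have hb0 : 0 ≤ (wNorm W B).toReal := ENNReal.toReal_nonneg
  have hη0 : 0 < η := by positivity
  obtain ⟨V, U, C, hC, hV, hU, hVW, hWV, hVU, hUU, hUW⟩ :=
    hν.exists_equivalent_weight hδ0 hC₀ hgrowth hz α hη0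
  have hBU : wNorm U B ≤ 4⁻¹ := by
    refine (wNorm_le_add (u := fun _ => 1) (v := W) B zero_le_four hη0.le hUW).trans ?_
    calc ENNReal.ofReal 4 * wNorm (fun _ => 1) B + ENNReal.ofReal η * wNorm W B
        ≤ ENNReal.ofReal 4 * ENNReal.ofReal (1 / 32) +
          ENNReal.ofReal η * ENNReal.ofReal (wNorm W B).toReal := by
          rw [ENNReal.ofReal_toReal hBW.ne]
          gcongr
      _ = ENNReal.ofReal (4 * (1 / 32) + η * (wNorm W B).toReal) := by
          rw [← ENNReal.ofReal_mul zero_le_four, ← ENNReal.ofReal_mul hη0.le,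
            ← ENNReal.ofReal_add (by norm_num) (by positivity)]
      _ ≤ ENNReal.ofReal (4⁻¹) := by
          refine ENNReal.ofReal_le_ofReal ?_
          have : η * (wNorm W B).toReal ≤ 1 / 8 := by
            rw [hη, div_mul_eq_mul_div, one_mul, div_le_iff₀ (by positivity)]
            linarith
          linarith
      _ = 4⁻¹ := by rw [ENNReal.ofReal_inv_of_pos four_pos, ENNReal.ofReal_ofNat]
  have hsum : Summable fun m : ℕ => B ^ m := summable_geometric_of_norm_lt_one hBn
  have hN : wNorm W (∑' m : ℕ, B ^ m) < ∞ :=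
    wNorm_tsum_pow_lt_top hC hV hU hVW hWV hVU hUU hsum hBW hBU
  have hRS : (1 - R) * S = (c : ℂ) • T' := by
    rw [hR, sub_sub_cancel, smul_mul_assoc, mul_assoc, hTS, mul_one]
  have hBS : (1 - B) * S = (∑ i ∈ Finset.range n, R ^ i) * ((c : ℂ) • T') := by
    rw [← hRS, ← mul_assoc, geom_sum_mul_neg]
  have hS : S = (∑' m : ℕ, B ^ m) * ((∑ i ∈ Finset.range n, R ^ i) * ((c : ℂ) • T')) := by
    rw [← hBS, ← mul_assoc, geom_series_mul_neg B hBn, one_mul]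
  rw [hS]
  exact hmul _ _ hN (hmul _ _ (wNorm_sum_lt_top fun i _ => wNorm_pow_lt_top R hW0 hWmul hRW i)
    (hsmul _ _ hT'W))

end InverseClosed
theorem statement19 {d : ℕ} (X : Set (Euc d)) (hX : RelSep X)
    (H : Type*) [NormedAddCommGroup H] [InnerProductSpace ℂ H] [CompleteSpace H]
    [TopologicalSpace.SeparableSpace H]
    (ν : Euc d → ℝ) (hνc : Continuous ν) (hνpos : ∀ x, 0 < ν x) (hν : Admissible ν)
    (δ C₀ : ℝ) (hδ0 : 0 < δ) (hδ1 : δ ≤ 1) (hC₀ : 0 < C₀)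
    (hgrowth : ∀ x : Euc d, C₀ * (1 + ‖x‖) ^ δ ≤ ν x)
    (α : Fin d → ℕ)
    (A : ↥X → ↥X → (H →L[ℂ] H)) (hA : MemAnisoSchur ν α A)
    (T : lp (fun _ : ↥X => H) 2 →L[ℂ] lp (fun _ : ↥X => H) 2)
    (hT : ∀ (f : lp (fun _ : ↥X => H) 2) (k : ↥X), T f k = ∑' l : ↥X, A k l (f l))
    (S : lp (fun _ : ↥X => H) 2 →L[ℂ] lp (fun _ : ↥X => H) 2)
    (hST : S.comp T = ContinuousLinearMap.id ℂ _)
    (hTS : T.comp S = ContinuousLinearMap.id ℂ _) :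
    ∃ B : ↥X → ↥X → (H →L[ℂ] H),
      (∀ (k l : ↥X) (f : H), B k l f = (S (deltaSeq 2 l f)) k) ∧
      MemAnisoSchur ν α B := by

  have hν0 : ∀ x, 0 ≤ ν x := fun x => (hνpos x).le
  refine ⟨entry S, fun _ _ _ => rfl, ?_⟩
  by_cases hd : ∃ z : Euc d, z ≠ 0
  · obtain ⟨z, hz⟩ := hd
    have hentry : entry T = A := by
      funext k l
      ext f
      rw [entry_apply, hT, tsum_eq_single l fun m hm => by
        rw [deltaSeq_apply_ne hm, map_zero], deltaSeq_apply_self]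
    rw [memAnisoSchur_entry_iff hν0]
    refine wNorm_inverse_lt_top hX hν hδ0 hδ1 hC₀ hgrowth hz α hST hTS ?_
    rwa [← memAnisoSchur_entry_iff hν0, hentry]
  · have hsub : Subsingleton (Euc d) := by
      push Not at hd
      exact ⟨fun x y => (hd x).trans (hd y).symm⟩
    have : Finite X := Subtype.finite
    exact ⟨fun _ => .of_finite, (Set.finite_range _).bddAbove, fun _ => .of_finite,
      (Set.finite_range _).bddAbove⟩
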